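/- arXiv:q-alg/9503013 — 3 statements merged into one kernel-verified Lean document; each statement's English description precedes it below -/
import Mathlib

section
/- There exists a unique symmetric ℚ-valued bilinear form s on X such that s(e(α), e(β)) = B(α, β) for all α, β ∈ Y. Moreover this form satisfies s(λ, e(i)) = d_i · λ_i for all λ ∈ X and i ∈ I, and det(c) · s(λ, μ) ∈ ℤ for all λ, μ ∈ X (so s takes values in (1/det c)·ℤ). -/
open scoped BigOperators

/-- The defining property of the bilinear form `s` on `X = I → ℤ`:
it is symmetric, biadditive, and extends the form
`B(α, β) = ∑ α_i β_j c i j` on `Y` via the embedding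
`e : Y → X`, `e α = fun j => ∑ i, α i * (c i j / d j)`. -/
def IsExtendingForm {I : Type} [Fintype I] (c : I → I → ℤ) (d : I → ℤ)
    (s : (I → ℤ) → (I → ℤ) → ℚ) : Prop :=
  (∀ lam mu, s lam mu = s mu lam) ∧
  (∀ lam lam' mu, s (lam + lam') mu = s lam mu + s lam' mu) ∧
  (∀ lam mu mu', s lam (mu + mu') = s lam mu + s lam mu') ∧
  (∀ α β : I → ℤ,
    s (fun j => ∑ i, α i * (c i j / d j)) (fun j => ∑ i, β i * (c i j / d j)) =
      ∑ i, ∑ j, (α i : ℚ) * (β j : ℚ) * (c i j : ℚ))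

open Matrix in
/-- The integral form `det c • s`, written through the adjugate of `c`. -/
def adjugateForm {I : Type} [Fintype I] [DecidableEq I] (c : I → I → ℤ) (d : I → ℤ)
    (lam mu : I → ℤ) : ℤ :=
  ((Matrix.of c).adjugate *ᵥ (d * lam)) ⬝ᵥ (d * mu)

section

open Matrix

variable {I : Type} {c : I → I → ℤ} {d : I → ℤ}

theorem transpose_of_symm (hsymm : ∀ i j, c i j = c j i) :
    (Matrix.of c)ᵀ = Matrix.of c := by
  ext i j
  exact hsymm j i

variable [Fintype I]

theorem mul_rootEmbedding (hsymm : ∀ i j, c i j = c j i) (hdvd : ∀ i j, d j ∣ c i j)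
    (α : I → ℤ) :
    (d * fun j => ∑ i, α i * (c i j / d j)) = Matrix.of c *ᵥ α := by
  ext j
  simp only [Pi.mul_apply, Finset.mul_sum, mulVec, dotProduct, of_apply]
  refine Finset.sum_congr rfl fun i _ => ?_
  rw [mul_left_comm, Int.mul_ediv_cancel' (hdvd i j), hsymm i j, mul_comm]

theorem IsExtendingForm.smul_right {s : (I → ℤ) → (I → ℤ) → ℚ}
    (hs : IsExtendingForm c d s) (n : ℤ) (lam mu : I → ℤ) :
    s lam (n • mu) = n * s lam mu := by
  simpa using map_zsmul (AddMonoidHom.mk' (s lam) (hs.2.2.1 lam)) n mu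

theorem IsExtendingForm.smul_left {s : (I → ℤ) → (I → ℤ) → ℚ}
    (hs : IsExtendingForm c d s) (n : ℤ) (lam mu : I → ℤ) :
    s (n • lam) mu = n * s lam mu := by
  rw [hs.1 (n • lam) mu, hs.smul_right, hs.1 mu lam]

variable [DecidableEq I]

theorem adjugateForm_comm (hsymm : ∀ i j, c i j = c j i) (lam mu : I → ℤ) :
    adjugateForm c d lam mu = adjugateForm c d mu lam := by
  unfold adjugateForm
  rw [dotProduct_comm, dotProduct_mulVec, ← mulVec_transpose, adjugate_transpose,
    transpose_of_symm hsymm]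

theorem adjugateForm_add_right (lam mu mu' : I → ℤ) :
    adjugateForm c d lam (mu + mu') = adjugateForm c d lam mu + adjugateForm c d lam mu' := by
  simp only [adjugateForm, mul_add, dotProduct_add]

theorem adjugateForm_rootEmbedding (hsymm : ∀ i j, c i j = c j i) (hdvd : ∀ i j, d j ∣ c i j)
    (lam β : I → ℤ) :
    adjugateForm c d lam (fun j => ∑ i, β i * (c i j / d j)) =
      (Matrix.of c).det * ((d * lam) ⬝ᵥ β) := by
  rw [adjugateForm, mul_rootEmbedding hsymm hdvd, dotProduct_mulVec, ← mulVec_transpose,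
    transpose_of_symm hsymm, mulVec_mulVec, mul_adjugate, smul_mulVec, one_mulVec,
    smul_dotProduct, smul_eq_mul]

theorem adjugateForm_rootEmbedding_rootEmbedding (hsymm : ∀ i j, c i j = c j i)
    (hdvd : ∀ i j, d j ∣ c i j) (α β : I → ℤ) :
    adjugateForm c d (fun j => ∑ i, α i * (c i j / d j)) (fun j => ∑ i, β i * (c i j / d j)) =
      (Matrix.of c).det * ∑ i, ∑ j, α i * β j * c i j := by
  rw [adjugateForm_rootEmbedding hsymm hdvd, mul_rootEmbedding hsymm hdvd, dotProduct_comm,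
    dotProduct_mulVec]
  simp only [dotProduct, vecMul, of_apply, Finset.sum_mul, Finset.mul_sum]
  refine Finset.sum_congr rfl fun i _ => Finset.sum_congr rfl fun j _ => ?_
  rw [hsymm j i]
  ring

theorem det_ne_zero_of_det_div_ne_zero (hsymm : ∀ i j, c i j = c j i)
    (hdpos : ∀ i, 0 < d i) (hdvd : ∀ i j, d j ∣ c i j)
    (hdet : (Matrix.of fun i j => c i j / d i).det ≠ 0) : (Matrix.of c).det ≠ 0 := by
  have h : Matrix.of c = diagonal d * Matrix.of fun i j => c i j / d i := by
    ext i j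
    rw [diagonal_mul, of_apply, of_apply, Int.mul_ediv_cancel' (hsymm i j ▸ hdvd j i)]
  rw [h, det_mul, det_diagonal]
  exact mul_ne_zero (Finset.prod_ne_zero_iff.mpr fun i _ => (hdpos i).ne') hdet

theorem rootEmbedding_adjugate (hsymm : ∀ i j, c i j = c j i)
    (hdpos : ∀ i, 0 < d i) (hdvd : ∀ i j, d j ∣ c i j) (lam : I → ℤ) :
    (fun j => ∑ i, ((Matrix.of c).adjugate *ᵥ (d * lam)) i * (c i j / d j)) =
      (Matrix.of c).det • lam := by
  have h := mul_rootEmbedding hsymm hdvd ((Matrix.of c).adjugate *ᵥ (d * lam))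
  rw [mulVec_mulVec, mul_adjugate, smul_mulVec, one_mulVec, ← mul_smul_comm] at h
  ext j
  exact mul_left_cancel₀ (hdpos j).ne' (congrFun h j)

namespace IsExtendingForm

variable {s : (I → ℤ) → (I → ℤ) → ℚ}

theorem det_mul_eq (hs : IsExtendingForm c d s) (hsymm : ∀ i j, c i j = c j i)
    (hdpos : ∀ i, 0 < d i) (hdvd : ∀ i j, d j ∣ c i j)
    (hdet : (Matrix.of c).det ≠ 0) (lam mu : I → ℤ) :
    ((Matrix.of c).det : ℚ) * s lam mu = adjugateForm c d lam mu := by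
  have hδ : ((Matrix.of c).det : ℚ) ≠ 0 := by exact_mod_cast hdet
  have h := hs.2.2.2 ((Matrix.of c).adjugate *ᵥ (d * lam)) ((Matrix.of c).adjugate *ᵥ (d * mu))
  have h' := adjugateForm_rootEmbedding_rootEmbedding hsymm hdvd
    ((Matrix.of c).adjugate *ᵥ (d * lam)) ((Matrix.of c).adjugate *ᵥ (d * mu))
  rw [adjugateForm_rootEmbedding hsymm hdvd] at h'
  have h'' := congrArg (Int.cast : ℤ → ℚ) (mul_left_cancel₀ hdet h')
  simp only [Int.cast_sum, Int.cast_mul] at h''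
  rw [← h, rootEmbedding_adjugate hsymm hdpos hdvd, rootEmbedding_adjugate hsymm hdpos hdvd,
    hs.smul_left, hs.smul_right, mul_smul_comm, smul_dotProduct, dotProduct_comm,
    smul_eq_mul, Int.cast_mul] at h''
  rw [adjugateForm_comm hsymm]
  exact (mul_left_cancel₀ hδ h'').symm

end IsExtendingForm

theorem isExtendingForm_adjugateForm_div (hsymm : ∀ i j, c i j = c j i)
    (hdvd : ∀ i j, d j ∣ c i j) (hdet : (Matrix.of c).det ≠ 0) :
    IsExtendingForm c d fun lam mu => (adjugateForm c d lam mu : ℚ) / (Matrix.of c).det := by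
  have hδ : ((Matrix.of c).det : ℚ) ≠ 0 := by exact_mod_cast hdet
  refine ⟨fun lam mu => ?_, fun lam lam' mu => ?_, fun lam mu mu' => ?_, fun α β => ?_⟩
  · simp only [adjugateForm_comm hsymm lam mu]
  · simp only [adjugateForm_comm hsymm _ mu, adjugateForm_add_right, Int.cast_add, add_div]
  · simp only [adjugateForm_add_right, Int.cast_add, add_div]
  · simp only [adjugateForm_rootEmbedding_rootEmbedding hsymm hdvd]
    rw [Int.cast_mul, mul_div_cancel_left₀ _ hδ]
    push_cast
    rfl

end

theorem stmt_0 {I : Type} [Fintype I] [DecidableEq I] [Nonempty I]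
    (c : I → I → ℤ) (d : I → ℤ)
    (hsymm : ∀ i j, c i j = c j i)
    (hdpos : ∀ i, 0 < d i)
    (hdiag : ∀ i, c i i = 2 * d i)
    (hdvd : ∀ i j, d j ∣ c i j)
    (hdet : (Matrix.of fun i j => c i j / d i).det ≠ 0) :
    (∃! s : (I → ℤ) → (I → ℤ) → ℚ, IsExtendingForm c d s) ∧
    (∀ s : (I → ℤ) → (I → ℤ) → ℚ, IsExtendingForm c d s →
      (∀ (lam : I → ℤ) (i : I),
          s lam (fun j => c i j / d j) = (d i : ℚ) * (lam i : ℚ)) ∧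
      (∀ lam mu, ∃ n : ℤ, ((Matrix.of c).det : ℚ) * s lam mu = (n : ℚ))) := by
  have hdet' := det_ne_zero_of_det_div_ne_zero hsymm hdpos hdvd hdet
  have hδ : ((Matrix.of c).det : ℚ) ≠ 0 := by exact_mod_cast hdet'
  refine ⟨⟨_, isExtendingForm_adjugateForm_div hsymm hdvd hdet', fun s hs => ?_⟩,
    fun s hs => ⟨fun lam i => ?_, fun lam mu =>
      ⟨_, hs.det_mul_eq hsymm hdpos hdvd hdet' lam mu⟩⟩⟩
  · funext lam mu
    rw [eq_div_iff hδ, mul_comm, hs.det_mul_eq hsymm hdpos hdvd hdet']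
  · have h := adjugateForm_rootEmbedding hsymm hdvd lam (Pi.single i 1)
    simp only [Pi.single_apply, ite_mul, one_mul, zero_mul, Finset.sum_ite_eq',
      Finset.mem_univ, if_true, dotProduct, mul_ite, mul_one, mul_zero,
      Pi.mul_apply] at h
    apply mul_left_cancel₀ hδ
    rw [hs.det_mul_eq hsymm hdpos hdvd hdet', h]
    push_cast
    rfl
end

section
/- If (ε_i, θ_i) is a C̃_ζ-structure on V, then the dual operators (ε_{i,DV}, θ_{i,DV}) form a C̃_{ζ^{-1}}-structure on DV; that is, for all λ ∈ X and i, j ∈ I, one has ε_{i,DV} ∘ θ_{j,DV} − ζ^{−(i·j)} · θ_{j,DV} ∘ ε_{i,DV} = δ_{ij} · (1 − ζ^{2(λ·i')}) · id as maps (DV)_λ → (DV)_{λ+i'−j'}. -/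
open scoped BigOperators

/-- Transport along an equality of indices, as a linear map. -/
def castLin {B : Type} [Field B] {X : Type} (V : X → Type)
    [∀ x, AddCommGroup (V x)] [∀ x, Module B (V x)]
    {a b : X} (h : a = b) : V a →ₗ[B] V b := by
  subst h; exact LinearMap.id

/-- A `C̃_ζ`-structure on an `X`-graded family `V` of `B`-vector spaces:
linear maps `ε_i : V_λ → V_{λ+i'}` and `θ_i : V_{λ+i'} → V_λ` satisfying
`ε_i θ_j - ζ^{i·j} θ_j ε_i = δ_{ij} (1 - ζ^{-2(λ·i')}) id` as maps
`V_λ → V_{λ+i'-j'}`. -/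
def CtildeStruct {B : Type} [Field B] {I : Type} [DecidableEq I]
    {X : Type} [AddCommGroup X]
    (ζ : Bˣ) (dot : X → X → ℤ) (i' : I → X)
    (V : X → Type) [∀ x, AddCommGroup (V x)] [∀ x, Module B (V x)]
    (ε : ∀ (i : I) (lam : X), V lam →ₗ[B] V (lam + i' i))
    (θ : ∀ (i : I) (lam : X), V (lam + i' i) →ₗ[B] V lam) : Prop :=
  ∀ (lam : X) (i j : I),
    (castLin V (show (lam - i' j) + i' i = lam + i' i - i' j by abel)
        ∘ₗ ε i (lam - i' j) ∘ₗ θ j (lam - i' j)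
        ∘ₗ castLin V (show lam = (lam - i' j) + i' j by abel))
      - ((ζ ^ (dot (i' i) (i' j)) : Bˣ) : B) •
        (θ j (lam + i' i - i' j)
          ∘ₗ castLin V (show lam + i' i = (lam + i' i - i' j) + i' j by abel)
          ∘ₗ ε i lam)
    = if h : i = j then
        ((1 : B) - ((ζ ^ (-(2 * dot lam (i' i))) : Bˣ) : B)) •
          castLin V (show lam = lam + i' i - i' j by subst h; abel)
      else 0

theorem castLin_dual_apply {B : Type} [Field B] {X : Type} (V : X → Type)
    [∀ x, AddCommGroup (V x)] [∀ x, Module B (V x)] {a b : X} (h : a = b)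
    (f : Module.Dual B (V a)) (v : V b) :
    (castLin (B := B) (fun x => Module.Dual B (V x)) h f : Module.Dual B (V b)) v
      = f (castLin (B := B) V h.symm v) := by
  subst h; rfl

/-- The defining relation of a `C̃_ζ`-structure, with the intermediate weights free up to
propositional equality. -/
theorem CtildeStruct.relation_apply {B : Type} [Field B] {I : Type} [DecidableEq I]
    {X : Type} [AddCommGroup X]
    {ζ : Bˣ} {dot : X → X → ℤ} {i' : I → X}
    {V : X → Type} [∀ x, AddCommGroup (V x)] [∀ x, Module B (V x)]
    {ε : ∀ (i : I) (lam : X), V lam →ₗ[B] V (lam + i' i)}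
    {θ : ∀ (i : I) (lam : X), V (lam + i' i) →ₗ[B] V lam}
    (hV : CtildeStruct ζ dot i' V ε θ) (i j : I) {lam kap rho : X}
    (hkap : lam = kap + i' j) (hrho : kap + i' i = rho) (hlam : lam + i' i = rho + i' j)
    (v : V lam) :
    castLin (B := B) V hrho (ε i kap (θ j kap (castLin (B := B) V hkap v)))
      - ((ζ ^ (dot (i' i) (i' j)) : Bˣ) : B) • θ j rho (castLin (B := B) V hlam (ε i lam v))
    = if h : i = j then
        ((1 : B) - ((ζ ^ (-(2 * dot lam (i' i))) : Bˣ) : B)) •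
          castLin (B := B) V (show lam = rho by rw [hkap, ← hrho, h]) v
      else 0 := by
  obtain rfl : kap = lam - i' j := eq_sub_of_add_eq hkap.symm
  obtain rfl : rho = lam + i' i - i' j := eq_sub_of_add_eq hlam.symm
  have key := LinearMap.congr_fun (hV lam i j) v
  by_cases h : i = j
  · simpa [h] using key
  · simpa [h] using key

/-- If `(ε_i, θ_i)` is a `C̃_ζ`-structure on `V`, then the dual operators
`ε_{i,DV} = (θ_i)^*` and `θ_{i,DV} = -ζ^{2((λ+i')·i')} (ε_i)^*` form a
`C̃_{ζ⁻¹}`-structure on the dual family `DV`. -/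
theorem stmt_3 {B : Type} [Field B] {I : Type} [DecidableEq I]
    {X : Type} [AddCommGroup X]
    (ζ : Bˣ) (dot : X → X → ℤ) (i' : I → X)
    (hdsymm : ∀ a b, dot a b = dot b a)
    (hdadd : ∀ a b c, dot (a + b) c = dot a c + dot b c)
    (V : X → Type) [∀ x, AddCommGroup (V x)] [∀ x, Module B (V x)]
    (ε : ∀ (i : I) (lam : X), V lam →ₗ[B] V (lam + i' i))
    (θ : ∀ (i : I) (lam : X), V (lam + i' i) →ₗ[B] V lam)
    (hV : CtildeStruct ζ dot i' V ε θ) :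
    CtildeStruct ζ⁻¹ dot i' (fun lam => Module.Dual B (V lam))
      (fun i lam => (θ i lam).dualMap)
      (fun i lam =>
        (-(((ζ ^ (2 * dot (lam + i' i) (i' i)) : Bˣ) : B))) • (ε i lam).dualMap) := by
  intro lam i j
  ext f v
  have key := congrArg f (CtildeStruct.relation_apply hV j i (lam := lam + i' i - i' j)
    (kap := lam - i' j) (rho := lam) (by abel) (by abel) (by abel) v)
  have hexp : ((ζ⁻¹ ^ dot (i' i) (i' j) : Bˣ) : B)
        * ((ζ ^ (2 * dot (lam + i' i - i' j + i' j) (i' j)) : Bˣ) : B)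
      = ((ζ ^ (2 * dot lam (i' j)) : Bˣ) : B) * ((ζ ^ dot (i' j) (i' i) : Bˣ) : B) := by
    rw [← Units.val_mul, ← Units.val_mul, inv_zpow', ← zpow_add, ← zpow_add,
      sub_add_cancel, hdadd, hdsymm (i' j)]
    congr 2
    ring
  have hlam : lam - i' j + i' j = lam := sub_add_cancel _ _
  have hinv : (ζ⁻¹ ^ (-(2 * dot lam (i' i))) : Bˣ) = ζ ^ (2 * dot lam (i' i)) := by
    rw [inv_zpow', neg_neg]
  simp only [map_sub, map_smul, smul_eq_mul] at key
  simp only [LinearMap.sub_apply, LinearMap.comp_apply, LinearMap.smul_apply,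
    castLin_dual_apply, map_smul, LinearMap.dualMap_apply, smul_eq_mul, hinv, hlam]
  rw [neg_mul, neg_mul, mul_neg, ← mul_assoc, hexp, sub_neg_eq_add]
  trans -((ζ ^ (2 * dot lam (i' j)) : Bˣ) : B) *
    f (if h : j = i then ((1 : B) - ((ζ ^ (-(2 * dot (lam + i' i - i' j) (i' j))) : Bˣ) : B)) •
      castLin (B := B) V (show lam + i' i - i' j = lam by rw [h]; abel) v else 0)
  · rw [← key]
    ring
  · by_cases h : i = j
    · subst h
      have hmul : ((ζ ^ (2 * dot lam (i' i)) : Bˣ) : B)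
          * ((ζ ^ (-(2 * dot lam (i' i))) : Bˣ) : B) = 1 := by
        rw [← Units.val_mul, ← zpow_add, add_neg_cancel, zpow_zero, Units.val_one]
      simp only [dite_true, map_smul, smul_eq_mul, LinearMap.smul_apply, castLin_dual_apply,
        add_sub_cancel_right]
      linear_combination f (castLin (B := B) V (add_sub_cancel_right lam (i' i)) v) * hmul
    · simp [h, Ne.symm h]
end

section
/- Assume each V_λ is finite-dimensional, the homomorphism ℤ[I] → X sending α to Σ_i α_i i' is injective, and (ε_i, θ_i) is a C̃_ζ-structure on V. Apply the duality D with parameter ζ to V and then the duality D with parameter ζ^{-1} to DV, obtaining a family with components (V_λ)^{**}. Then there exists a family of B-linear isomorphisms φ_λ : V_λ → (V_λ)^{**}, each equal to a nonzero scalar multiple of the canonical evaluation map, which intertwines the operators: φ_{λ+i'} ∘ ε_{i,V} = ε_{i,D_{ζ^{-1}}D_ζV} ∘ φ_λ and φ_λ ∘ θ_{i,V} = θ_{i,D_{ζ^{-1}}D_ζV} ∘ φ_{λ+i'} for all i ∈ I and λ ∈ X. (Hence the duality D is a contravariant equivalence interchanging the parameters ζ and ζ^{-1}.) -/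
open scoped BigOperators

/-- An injective additive map `f : A → X` admits a (set-theoretic) retraction that is equivariant
for translation by the image of `f`. -/
theorem exists_equivariant_retraction {A X : Type*} [AddCommGroup A] [AddCommGroup X]
    (f : A →+ X) (hf : Function.Injective f) :
    ∃ r : X → A, ∀ x a, r (x + f a) = r x + a := by
  have hmem : ∀ x : X, ∃ a, f a = x - (QuotientAddGroup.mk x : X ⧸ f.range).out := fun x =>
    f.mem_range.mp <| by
      have h := QuotientAddGroup.eq.mp (Quotient.out_eq (QuotientAddGroup.mk x : X ⧸ f.range))
      rwa [neg_add_eq_sub] at h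
  choose r hr using hmem
  refine ⟨r, fun x a => hf ?_⟩
  have h : (QuotientAddGroup.mk (x + f a) : X ⧸ f.range) = QuotientAddGroup.mk x :=
    (QuotientAddGroup.eq.mpr (by simp)).symm
  rw [map_add, hr, hr, h]
  abel

/-- If the `i'` are linearly independent over `ℤ`, there is a function `c : X → Bˣ` with
`c (λ + i') = -ζ ^ (2 (λ + i')·i') c λ`. -/
theorem exists_scalar_cocycle {B : Type*} [Field B] {I : Type*} [DecidableEq I] [Fintype I]
    {X : Type*} [AddCommGroup X] (ζ : Bˣ) (dot : X → X → ℤ) (i' : I → X)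
    (hdsymm : ∀ a b, dot a b = dot b a)
    (hdadd : ∀ a b c, dot (a + b) c = dot a c + dot b c)
    (hinj : Function.Injective (fun α : I → ℤ => ∑ i, α i • i' i)) :
    ∃ c : X → Bˣ, ∀ i lam,
      c (lam + i' i) = -ζ ^ (2 * dot (lam + i' i) (i' i)) * c lam := by
  obtain ⟨r, hr⟩ := exists_equivariant_retraction
    (Fintype.linearCombination ℤ i').toAddMonoidHom hinj
  have hr' : ∀ lam i, r (lam + i' i) = r lam + Pi.single i 1 := fun lam i => by
    simpa [Fintype.linearCombination_apply_single] using hr lam (Pi.single i 1)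
  refine ⟨fun lam => (-1) ^ (∑ i, r lam i) *
    ζ ^ (dot lam lam + ∑ i, r lam i * dot (i' i) (i' i)), fun i lam => ?_⟩
  have hsum : ∑ j, r (lam + i' i) j = ∑ j, r lam j + 1 := by
    simp [hr', Finset.sum_add_distrib]
  have hexp : dot (lam + i' i) (lam + i' i) + ∑ j, r (lam + i' i) j * dot (i' j) (i' j) =
      2 * dot (lam + i' i) (i' i) + (dot lam lam + ∑ j, r lam j * dot (i' j) (i' j)) := by
    have h : ∑ j, r (lam + i' i) j * dot (i' j) (i' j) =
        ∑ j, r lam j * dot (i' j) (i' j) + dot (i' i) (i' i) := by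
      simp [hr', add_mul, Finset.sum_add_distrib, Pi.single_apply]
    rw [h, hdadd lam (i' i) (lam + i' i), hdsymm lam (lam + i' i),
      hdsymm (i' i) (lam + i' i), hdadd, hdadd, hdsymm (i' i) lam]
    ring
  simp only [hsum, hexp, zpow_add, zpow_one]
  simp only [mul_neg, neg_mul, mul_one, neg_inj]
  exact mul_left_comm _ _ _

/-- Applying the duality `D` with parameter `ζ` and then the duality `D` with
parameter `ζ⁻¹` to a `C̃_ζ`-structure on a family of finite-dimensional spaces
gives a family canonically isomorphic to the original one: there are
isomorphisms `φ_λ : V_λ ≅ (V_λ)^{**}`, each a nonzero scalar multiple of the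
canonical evaluation map, intertwining the operators. Here
`ε_{i,DDV} = ((θ_{i,DV}))^* = ((-ζ^{2((λ+i')·i')}) • (ε_i)^*)^*` and
`θ_{i,DDV} = -ζ⁻¹^{2((λ+i')·i')} • (ε_{i,DV})^* = -ζ⁻¹^{2((λ+i')·i')} • ((θ_i)^*)^*`. -/
theorem stmt_4 {B : Type} [Field B] {I : Type} [DecidableEq I] [Fintype I]
    {X : Type} [AddCommGroup X]
    (ζ : Bˣ) (dot : X → X → ℤ) (i' : I → X)
    (hdsymm : ∀ a b, dot a b = dot b a)
    (hdadd : ∀ a b c, dot (a + b) c = dot a c + dot b c)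
    (hinj : Function.Injective (fun α : I → ℤ => ∑ i, α i • i' i))
    (V : X → Type) [∀ x, AddCommGroup (V x)] [∀ x, Module B (V x)]
    [∀ x, FiniteDimensional B (V x)]
    (ε : ∀ (i : I) (lam : X), V lam →ₗ[B] V (lam + i' i))
    (θ : ∀ (i : I) (lam : X), V (lam + i' i) →ₗ[B] V lam)
    (hV : CtildeStruct ζ dot i' V ε θ) :
    ∃ φ : ∀ lam : X, V lam →ₗ[B] Module.Dual B (Module.Dual B (V lam)),
      (∀ lam, Function.Bijective (φ lam)) ∧
      (∀ lam, ∃ cst : B, cst ≠ 0 ∧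
        φ lam = cst • Module.Dual.eval B (V lam)) ∧
      (∀ (i : I) (lam : X),
        φ (lam + i' i) ∘ₗ ε i lam =
          (LinearMap.dualMap
            ((-(((ζ ^ (2 * dot (lam + i' i) (i' i)) : Bˣ) : B))) •
              (ε i lam).dualMap)) ∘ₗ φ lam) ∧
      (∀ (i : I) (lam : X),
        φ lam ∘ₗ θ i lam =
          ((-(((ζ⁻¹ ^ (2 * dot (lam + i' i) (i' i)) : Bˣ) : B))) •
            LinearMap.dualMap ((θ i lam).dualMap)) ∘ₗ φ (lam + i' i)) := by
  obtain ⟨c, hc⟩ := exists_scalar_cocycle ζ dot i' hdsymm hdadd hinj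
  refine ⟨fun lam => (c lam : B) • Module.Dual.eval B (V lam), fun lam => ?_,
    fun lam => ⟨c lam, (c lam).ne_zero, rfl⟩, fun i lam => ?_, fun i lam => ?_⟩
  · exact ((LinearEquiv.smulOfUnit (c lam)).bijective.comp
      (Module.evalEquiv B (V lam)).bijective :)
  · ext v f
    simp only [hc, Units.val_mul, Units.val_neg, LinearMap.comp_apply, LinearMap.smul_apply,
      LinearMap.dualMap_apply, Module.Dual.eval_apply, map_smul, smul_eq_mul]
    ring
  · have h : (c lam : B) =
        -((ζ⁻¹ ^ (2 * dot (lam + i' i) (i' i)) : Bˣ) : B) * c (lam + i' i) := by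
      rw [hc, ← Units.val_neg, ← Units.val_mul, ← mul_assoc, neg_mul_neg, inv_zpow,
        inv_mul_cancel, one_mul]
    ext v f
    simp only [h, LinearMap.comp_apply, LinearMap.smul_apply, LinearMap.dualMap_apply,
      Module.Dual.eval_apply, map_smul, smul_eq_mul]
    ring
end
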